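/- arXiv:1110.4284 — 5 statements merged into one kernel-verified Lean document; each statement's English description precedes it below -/
import Mathlib

section
/- For every real u with 0 ≤ u ≤ 1, the integral H(u) := ∫₀^{1−u} 2(1−x) √( ((1−x)² − u²) / (x(2−x)) ) dx evaluates to H(u) = (π/2)(1 − u²). -/
theorem G_deriv (c v : ℝ) (hv : 0 < v) (hvc : v < c) :
    HasDerivAt (fun v : ℝ => Real.sqrt (v * (c - v)) + c / 2 * Real.arcsin (2 * v / c - 1))
      (Real.sqrt ((c - v) / v)) v := by
  have hc : 0 < c := hv.trans hvc
  have hw : 0 < c - v := sub_pos.2 hvc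
  have hp : 0 < v * (c - v) := mul_pos hv hw
  have h1 : HasDerivAt (fun v : ℝ => v * (c - v)) (1 * (c - v) + v * (-1)) v :=
    (hasDerivAt_id v).mul ((hasDerivAt_id v).const_sub c)
  have h2 := h1.sqrt hp.ne'
  have h3 : HasDerivAt (fun v : ℝ => 2 * v / c - 1) (2 * 1 / c) v :=
    (((hasDerivAt_id v).const_mul 2).div_const c).sub_const 1
  have hlt : 2 * v / c - 1 < 1 := by
    rw [sub_lt_iff_lt_add, div_lt_iff₀ hc]; linarith
  have hgt : -1 < 2 * v / c - 1 := by
    have : 0 < 2 * v / c := by positivity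
    linarith
  have h4 := ((Real.hasDerivAt_arcsin hgt.ne' hlt.ne).comp v h3).const_mul (c / 2)
  have h5 := h2.add h4
  refine h5.congr_deriv ?_
  have e1 : Real.sqrt (1 - (2 * v / c - 1) ^ 2) = 2 / c * Real.sqrt (v * (c - v)) := by
    rw [show 1 - (2 * v / c - 1) ^ 2 = (2 / c) ^ 2 * (v * (c - v)) by field_simp; ring,
      Real.sqrt_mul (by positivity), Real.sqrt_sq (by positivity)]
  rw [e1, Real.sqrt_mul hv.le, Real.sqrt_div hw.le]
  have a := Real.sqrt_pos.2 hv
  have b := Real.sqrt_pos.2 hw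
  have a2 := Real.sq_sqrt hv.le
  have b2 := Real.sq_sqrt hw.le
  field_simp
  rw [b2]
  ring

/-- Lemma 2 of the paper: the soft-edge electrostatic energy integral
`H(u) = ∫₀^{1-u} 2(1-x) √(((1-x)² - u²)/(x(2-x))) dx = (π/2)(1-u²)`. -/
theorem stmt0 (u : ℝ) (hu0 : 0 ≤ u) (hu1 : u ≤ 1) :
    (∫ x in (0:ℝ)..(1 - u),
        2 * (1 - x) * Real.sqrt (((1 - x) ^ 2 - u ^ 2) / (x * (2 - x))))
      = Real.pi / 2 * (1 - u ^ 2) := by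
  rcases hu1.eq_or_lt with rfl | hu
  · simp
  have hab : (0:ℝ) ≤ 1 - u := by linarith
  have hc : 0 < 1 - u ^ 2 := by nlinarith
  let G : ℝ → ℝ := fun v => Real.sqrt (v * ((1 - u ^ 2) - v))
    + (1 - u ^ 2) / 2 * Real.arcsin (2 * v / (1 - u ^ 2) - 1)
  have hG : Continuous G := by
    have := Real.continuous_arcsin
    fun_prop
  have hcont : Continuous (fun x : ℝ => G (x * (2 - x))) := by fun_prop
  have hd : ∀ x ∈ Set.Ioo (0:ℝ) (1 - u), HasDerivAt (fun x : ℝ => G (x * (2 - x)))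
      (2 * (1 - x) * Real.sqrt (((1 - x) ^ 2 - u ^ 2) / (x * (2 - x)))) x := by
    rintro x ⟨h0, h1⟩
    have hq : HasDerivAt (fun x : ℝ => x * (2 - x)) (1 * (2 - x) + x * (-1)) x :=
      (hasDerivAt_id x).mul ((hasDerivAt_id x).const_sub 2)
    have hg := (G_deriv (1 - u ^ 2) (x * (2 - x)) (mul_pos h0 (by linarith)) (by nlinarith)).comp x hq
    refine hg.congr_deriv ?_
    rw [show (1 - u ^ 2) - x * (2 - x) = (1 - x) ^ 2 - u ^ 2 by ring]
    ring
  have hint := intervalIntegral.intervalIntegrable_deriv_of_nonneg (a := 0) (b := 1 - u)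
    hcont.continuousOn (by rwa [min_eq_left hab, max_eq_right hab]) (by
      rw [min_eq_left hab, max_eq_right hab]
      rintro x ⟨h0, h1⟩
      exact mul_nonneg (by linarith) (Real.sqrt_nonneg _))
  rw [intervalIntegral.integral_eq_sub_of_hasDerivAt_of_le hab hcont.continuousOn hd hint]
  have e : (1 - u) * (2 - (1 - u)) = 1 - u ^ 2 := by ring
  have e2 : 2 * (1 - u ^ 2) / (1 - u ^ 2) - 1 = 1 := by field_simp; norm_num
  simp only [G, e, e2]
  simp
  ring
end

section
/- Let 0 < b₁ ≤ b₂, set t = b₁ + b₂ and m = 1 − b₁/b₂. Then ∫_{b₁}^{b₂} √( (x−b₁)(b₂−x)/(t−x) ) dx = (2/3) √b₂ ( t E(m) − 2 b₁ K(m) ), where K(m) = ∫₀^{π/2} (1 − m sin²θ)^{−1/2} dθ and E(m) = ∫₀^{π/2} (1 − m sin²θ)^{1/2} dθ are the complete elliptic integrals with parameter m. -/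
/-- The complete elliptic integral of the first kind, `K(m) = ∫₀^{π/2} (1 - m sin²θ)^{-1/2} dθ`,
with parameter `m`. -/
noncomputable def ellipticK (m : ℝ) : ℝ :=
  ∫ θ in (0:ℝ)..(Real.pi / 2), (1 - m * Real.sin θ ^ 2) ^ (-(1/2) : ℝ)

/-- The complete elliptic integral of the second kind, `E(m) = ∫₀^{π/2} (1 - m sin²θ)^{1/2} dθ`,
with parameter `m`. -/
noncomputable def ellipticE (m : ℝ) : ℝ :=
  ∫ θ in (0:ℝ)..(Real.pi / 2), (1 - m * Real.sin θ ^ 2) ^ ((1/2) : ℝ)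

/-- Soft-edge particle-number constraint:
`∫_{b₁}^{b₂} √((x-b₁)(b₂-x)/(t-x)) dx = (2/3)√b₂ (t E(m) - 2 b₁ K(m))`
with `t = b₁ + b₂` and `m = 1 - b₁/b₂`. -/
theorem stmt8 (b₁ b₂ t m : ℝ) (hb₁ : 0 < b₁) (hb : b₁ ≤ b₂) (ht : t = b₁ + b₂)
    (hm : m = 1 - b₁ / b₂) :
    (∫ x in b₁..b₂, Real.sqrt ((x - b₁) * (b₂ - x) / (t - x)))
      = 2 / 3 * Real.sqrt b₂ * (t * ellipticE m - 2 * b₁ * ellipticK m) := by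
  have hb₂ : 0 < b₂ := lt_of_lt_of_le hb₁ hb
  have hm1 : 1 - m = b₁ / b₂ := by rw [hm]; ring
  have hb1m : b₁ = b₂ * (1 - m) := by rw [hm1]; field_simp
  have hmlt : 0 < 1 - m := by rw [hm1]; positivity
  have hm0 : 0 ≤ m := by
    rw [hm, sub_nonneg, div_le_one hb₂]; exact hb
  have hD : ∀ θ : ℝ, 0 < 1 - m * Real.sin θ ^ 2 := fun θ => by
    nlinarith [Real.sin_sq_le_one θ]
  have hr : ∀ θ : ℝ, 0 < Real.sqrt (1 - m * Real.sin θ ^ 2) := fun θ => Real.sqrt_pos.2 (hD θ)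
  have hrs : ∀ θ : ℝ, Real.sqrt (1 - m * Real.sin θ ^ 2) ^ 2 = 1 - m * Real.sin θ ^ 2 :=
    fun θ => Real.sq_sqrt (hD θ).le
  have hcr : Continuous fun θ : ℝ => Real.sqrt (1 - m * Real.sin θ ^ 2) := by fun_prop
  have hcri : Continuous fun θ : ℝ => (Real.sqrt (1 - m * Real.sin θ ^ 2))⁻¹ :=
    hcr.inv₀ fun θ => (hr θ).ne'
  have hE : ellipticE m = ∫ θ in (0:ℝ)..(Real.pi / 2), Real.sqrt (1 - m * Real.sin θ ^ 2) := by
    unfold ellipticE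
    simp only [Real.sqrt_eq_rpow]
  have hK : ellipticK m
      = ∫ θ in (0:ℝ)..(Real.pi / 2), (Real.sqrt (1 - m * Real.sin θ ^ 2))⁻¹ := by
    unfold ellipticK
    refine intervalIntegral.integral_congr fun θ _ => ?_
    simp only [Real.sqrt_eq_rpow]
    rw [Real.rpow_neg (hD θ).le]
  have hpi : (0:ℝ) ≤ Real.pi / 2 := by positivity
  -- substitution
  have hsub := intervalIntegral.integral_comp_mul_deriv' (a := 0) (b := Real.pi / 2)
    (f := fun θ => b₁ + b₂ * m * Real.sin θ ^ 2)
    (f' := fun θ => 2 * (b₂ * m) * Real.sin θ * Real.cos θ)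
    (g := fun x => Real.sqrt ((x - b₁) * (b₂ - x) / (t - x)))
    (fun θ _ => by
      have h := (((Real.hasDerivAt_sin θ).pow 2).const_mul (b₂ * m)).const_add b₁
      refine h.congr_deriv ?_
      push_cast
      ring)
    (by fun_prop)
    (by
      apply Continuous.comp_continuousOn Real.continuous_sqrt
      apply ContinuousOn.div (by fun_prop) (by fun_prop)
      rintro x ⟨θ, _, rfl⟩
      have := mul_pos hb₂ (hD θ)
      show t - (b₁ + b₂ * m * Real.sin θ ^ 2) ≠ 0
      rw [ht]
      apply ne_of_gt
      nlinarith)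
  have e1 : b₁ + b₂ * m * Real.sin (Real.pi / 2) ^ 2 = b₂ := by
    rw [Real.sin_pi_div_two, hb1m]; ring
  have e0 : b₁ + b₂ * m * Real.sin 0 ^ 2 = b₁ := by simp
  simp only [e1, e0] at hsub
  rw [← hsub]
  -- the exact derivative
  set F : ℝ → ℝ := fun θ => Real.sin θ * Real.cos θ * Real.sqrt (1 - m * Real.sin θ ^ 2) with hF
  set F' : ℝ → ℝ := fun θ =>
    (1 - 2 * Real.sin θ ^ 2 - 2 * m * Real.sin θ ^ 2 + 3 * m * Real.sin θ ^ 4)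
      * (Real.sqrt (1 - m * Real.sin θ ^ 2))⁻¹ with hF'
  have hcF' : Continuous F' := by
    apply Continuous.mul _ hcri
    fun_prop
  have hFd : ∀ θ, HasDerivAt F (F' θ) θ := fun θ => by
    have h1 := ((((Real.hasDerivAt_sin θ).pow 2).const_mul m).const_sub 1).sqrt (hD θ).ne'
    have h2 := ((Real.hasDerivAt_sin θ).mul (Real.hasDerivAt_cos θ)).mul h1
    refine h2.congr_deriv ?_
    have hc := Real.cos_sq' θ
    have h3 := hrs θ
    have h4 := (hr θ).ne'
    simp only [hF', Pi.mul_apply, Pi.pow_apply]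
    generalize Real.sqrt (1 - m * Real.sin θ ^ 2) = r at *
    field_simp
    simp only [h3, hc]
    push_cast
    ring_nf
    try simp only [hc]
    try ring
  have hI : ∫ θ in (0:ℝ)..(Real.pi / 2), F' θ = 0 := by
    rw [intervalIntegral.integral_eq_sub_of_hasDerivAt (fun θ _ => hFd θ)
      (hcF'.intervalIntegrable _ _)]
    simp [hF]
  have key : ∫ θ in (0:ℝ)..(Real.pi / 2),
      ((fun x => Real.sqrt ((x - b₁) * (b₂ - x) / (t - x))) ∘
        fun θ => b₁ + b₂ * m * Real.sin θ ^ 2) θ * (2 * (b₂ * m) * Real.sin θ * Real.cos θ)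
      = ∫ θ in (0:ℝ)..(Real.pi / 2),
        ((2 / 3 * Real.sqrt b₂ * t * Real.sqrt (1 - m * Real.sin θ ^ 2)
          - 2 / 3 * Real.sqrt b₂ * (2 * b₁) * (Real.sqrt (1 - m * Real.sin θ ^ 2))⁻¹)
          - 2 / 3 * Real.sqrt b₂ * b₂ * m * F' θ) := by
    refine intervalIntegral.integral_congr fun θ hθ => ?_
    rw [Set.uIcc_of_le hpi] at hθ
    have hs : 0 ≤ Real.sin θ := Real.sin_nonneg_of_nonneg_of_le_pi hθ.1 (by linarith [hθ.2])
    have hc : 0 ≤ Real.cos θ := Real.cos_nonneg_of_mem_Icc ⟨by linarith [hθ.1], hθ.2⟩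
    have hc2 := Real.cos_sq' θ
    have hq : Real.sqrt b₂ ^ 2 = b₂ := Real.sq_sqrt hb₂.le
    have hq0 : 0 < Real.sqrt b₂ := Real.sqrt_pos.2 hb₂
    have h3 := hrs θ
    have h4 := hr θ
    have hD' := hD θ
    have hs1 : Real.sqrt ((b₁ + b₂ * m * Real.sin θ ^ 2 - b₁) *
        (b₂ - (b₁ + b₂ * m * Real.sin θ ^ 2)) / (t - (b₁ + b₂ * m * Real.sin θ ^ 2)))
        = Real.sqrt b₂ * m * Real.sin θ * Real.cos θ
          * (Real.sqrt (1 - m * Real.sin θ ^ 2))⁻¹ := by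
      have e : (b₁ + b₂ * m * Real.sin θ ^ 2 - b₁) *
        (b₂ - (b₁ + b₂ * m * Real.sin θ ^ 2)) / (t - (b₁ + b₂ * m * Real.sin θ ^ 2))
        = (Real.sqrt b₂ * m * Real.sin θ * Real.cos θ
          * (Real.sqrt (1 - m * Real.sin θ ^ 2))⁻¹) ^ 2 := by
        have ed : t - (b₁ + b₂ * m * Real.sin θ ^ 2) = b₂ * (1 - m * Real.sin θ ^ 2) := by
          rw [ht]; ring
        rw [ed, mul_pow, mul_pow, mul_pow, mul_pow, inv_pow, h3, hq, hc2, hb1m]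
        field_simp
        ring
      rw [e, Real.sqrt_sq (by positivity)]
    simp only [Function.comp_apply, hs1, hF']
    generalize Real.sqrt (1 - m * Real.sin θ ^ 2) = r at *
    rw [ht, hb1m]
    field_simp
    simp only [h3, hc2]
    ring
  rw [key, intervalIntegral.integral_sub, intervalIntegral.integral_sub]
  · simp only [intervalIntegral.integral_const_mul]
    rw [hI, hE, hK]; ring
  all_goals apply Continuous.intervalIntegrable
  all_goals fun_prop
end

section
/- Let 0 < b₁ ≤ b₂, set t = b₁ + b₂ and m = b₁/b₂. Then ∫_{b₂}^{t} √( (x−b₁)(x−b₂)/(t−x) ) dx = (2/3) √b₂ ( t E(m) − (b₂−b₁) K(m) ), where K(m) = ∫₀^{π/2} (1 − m sin²θ)^{−1/2} dθ and E(m) = ∫₀^{π/2} (1 − m sin²θ)^{1/2} dθ are the complete elliptic integrals with parameter m. -/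
lemma aux_pos (m θ : ℝ) (hm0 : 0 < m) (hm1 : m ≤ 1) (h0 : 0 < θ) (h1 : θ < Real.pi / 2) :
    0 < 1 - m * Real.sin θ ^ 2 := by
  have hc : 0 < Real.cos θ := Real.cos_pos_of_mem_Ioo ⟨by linarith, h1⟩
  have := Real.sin_sq_add_cos_sq θ
  have hc2 : 0 < Real.cos θ ^ 2 := by positivity
  nlinarith [sq_nonneg (Real.sin θ)]

lemma aux_int (m : ℝ) (hm0 : 0 < m) (hm1 : m ≤ 1) :
    3 * m * (∫ θ in (0:ℝ)..(Real.pi / 2), Real.cos θ ^ 2 * Real.sqrt (1 - m * Real.sin θ ^ 2))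
      = (1 + m) * ellipticE m - (1 - m) * ellipticK m := by
  have hpi := Real.pi_pos
  have hE : ellipticE m = ∫ θ in (0:ℝ)..(Real.pi / 2), Real.sqrt (1 - m * Real.sin θ ^ 2) := by
    unfold ellipticE
    simp only [← Real.sqrt_eq_rpow]
  have hK : (1 - m) * ellipticK m
      = ∫ θ in (0:ℝ)..(Real.pi / 2), (1 - m) * (Real.sqrt (1 - m * Real.sin θ ^ 2))⁻¹ := by
    rw [intervalIntegral.integral_const_mul]
    congr 1
    unfold ellipticK
    apply intervalIntegral.integral_congr
    intro θ _
    have : 0 ≤ 1 - m * Real.sin θ ^ 2 := by nlinarith [Real.sin_sq_le_one θ, sq_nonneg (Real.sin θ)]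
    simp only [Real.rpow_neg this, ← Real.sqrt_eq_rpow]
  have i1 : IntervalIntegrable (fun θ => 3 * m * (Real.cos θ ^ 2 * Real.sqrt (1 - m * Real.sin θ ^ 2)))
      MeasureTheory.volume 0 (Real.pi / 2) :=
    Continuous.intervalIntegrable (by fun_prop) _ _
  have i2 : IntervalIntegrable (fun θ => (1 + m) * Real.sqrt (1 - m * Real.sin θ ^ 2))
      MeasureTheory.volume 0 (Real.pi / 2) :=
    Continuous.intervalIntegrable (by fun_prop) _ _
  have i3 : IntervalIntegrable (fun θ => (1 - m) * (Real.sqrt (1 - m * Real.sin θ ^ 2))⁻¹)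
      MeasureTheory.volume 0 (Real.pi / 2) := by
    rcases hm1.eq_or_lt with h | h
    · subst h
      simp
    · apply Continuous.intervalIntegrable
      have : ∀ θ, Real.sqrt (1 - m * Real.sin θ ^ 2) ≠ 0 := by
        intro θ
        have : 0 < 1 - m * Real.sin θ ^ 2 := by
          nlinarith [Real.sin_sq_le_one θ, sq_nonneg (Real.sin θ)]
        positivity
      fun_prop (disch := assumption)
  have key := intervalIntegral.integral_eq_sub_of_hasDerivAt_of_le (a := 0) (b := Real.pi / 2)
    (f := fun θ => m * (Real.sin θ * Real.cos θ * Real.sqrt (1 - m * Real.sin θ ^ 2)))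
    (f' := fun θ => 3 * m * (Real.cos θ ^ 2 * Real.sqrt (1 - m * Real.sin θ ^ 2))
      - (1 + m) * Real.sqrt (1 - m * Real.sin θ ^ 2)
      + (1 - m) * (Real.sqrt (1 - m * Real.sin θ ^ 2))⁻¹)
    (by positivity) (by fun_prop) ?_ ((i1.sub i2).add i3)
  · rw [intervalIntegral.integral_add (i1.sub i2) i3, intervalIntegral.integral_sub i1 i2,
      intervalIntegral.integral_const_mul, intervalIntegral.integral_const_mul, ← hK, ← hE] at key
    simp at key
    linarith
  · intro θ hθ
    have hp := aux_pos m θ hm0 hm1 hθ.1 hθ.2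
    have hd : HasDerivAt (fun θ => 1 - m * Real.sin θ ^ 2)
        (-(m * (2 * Real.sin θ * Real.cos θ))) θ := by
      have := (((Real.hasDerivAt_sin θ).pow 2).const_mul m).const_sub 1
      simpa using this
    have h := (((Real.hasDerivAt_sin θ).mul (Real.hasDerivAt_cos θ)).mul
      (hd.sqrt hp.ne')).const_mul m
    refine h.congr_deriv ?_
    have hs := Real.sq_sqrt hp.le
    have hsp := Real.sqrt_pos.2 hp
    simp only [Pi.mul_apply]
    set r := Real.sqrt (1 - m * Real.sin θ ^ 2) with hr
    have hc := Real.cos_sq' θ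
    field_simp
    have e4 : Real.cos θ ^ 2 = 1 - Real.sin θ ^ 2 := hc
    simp only [hs, e4]
    ring

/-- Soft-edge potential drop:
`∫_{b₂}^{t} √((x-b₁)(x-b₂)/(t-x)) dx = (2/3)√b₂ (t E(m) - (b₂-b₁) K(m))`
with `t = b₁ + b₂` and `m = b₁/b₂`. -/
theorem stmt9 (b₁ b₂ t m : ℝ) (hb₁ : 0 < b₁) (hb : b₁ ≤ b₂) (ht : t = b₁ + b₂)
    (hm : m = b₁ / b₂) :
    (∫ x in b₂..t, Real.sqrt ((x - b₁) * (x - b₂) / (t - x)))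
      = 2 / 3 * Real.sqrt b₂ * (t * ellipticE m - (b₂ - b₁) * ellipticK m) := by
  have hb₂ : 0 < b₂ := by linarith
  have hm0 : 0 < m := by rw [hm]; positivity
  have hm1 : m ≤ 1 := by rw [hm]; exact (div_le_one hb₂).2 hb
  have hmb : b₁ = m * b₂ := by rw [hm]; field_simp
  have hpi := Real.pi_pos
  have hsin : ∀ θ ∈ Set.Ioo 0 (Real.pi / 2), 0 < Real.sin θ := fun θ hθ =>
    Real.sin_pos_of_pos_of_lt_pi hθ.1 (by linarith [hθ.2])
  have hcos : ∀ θ ∈ Set.Ioo 0 (Real.pi / 2), 0 < Real.cos θ := fun θ hθ =>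
    Real.cos_pos_of_mem_Ioo ⟨by linarith [hθ.1], hθ.2⟩
  have himg : (fun θ => t - b₁ * Real.sin θ ^ 2) '' Set.Ioo 0 (Real.pi / 2) = Set.Ioo b₂ t := by
    ext x
    constructor
    · rintro ⟨θ, hθ, rfl⟩
      have h1 := hsin θ hθ
      have h2 := hcos θ hθ
      have h3 := Real.sin_sq_add_cos_sq θ
      constructor
      · have : 0 < b₁ * Real.cos θ ^ 2 := by positivity
        simp only
        nlinarith
      · have : 0 < b₁ * Real.sin θ ^ 2 := by positivity
        simp only
        linarith
    · rintro ⟨h1, h2⟩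
      have q0 : 0 < (t - x) / b₁ := div_pos (by linarith) hb₁
      have q1 : (t - x) / b₁ < 1 := (div_lt_one hb₁).2 (by linarith)
      have s0 := Real.sqrt_pos.2 q0
      have s1 : Real.sqrt ((t - x) / b₁) < 1 := by
        rw [Real.sqrt_lt' one_pos]; simpa using q1
      refine ⟨Real.arcsin (Real.sqrt ((t - x) / b₁)),
        ⟨Real.arcsin_pos.2 s0, Real.arcsin_lt_pi_div_two.2 s1⟩, ?_⟩
      simp only
      rw [Real.sin_arcsin (by linarith) s1.le, Real.sq_sqrt q0.le]
      field_simp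
      ring
  have hinj : Set.InjOn (fun θ => t - b₁ * Real.sin θ ^ 2) (Set.Ioo 0 (Real.pi / 2)) := by
    intro x hx y hy hxy
    have h1 := hsin x hx
    have h2 := hsin y hy
    have h3 : Real.sin x ^ 2 = Real.sin y ^ 2 := by
      have : b₁ * Real.sin x ^ 2 = b₁ * Real.sin y ^ 2 := by
        simp only at hxy
        linarith
      exact mul_left_cancel₀ hb₁.ne' this
    have h4 : Real.sin x = Real.sin y := by
      rwa [sq_eq_sq₀ h1.le h2.le] at h3
    exact Real.injOn_sin ⟨by linarith [hx.1], hx.2.le⟩ ⟨by linarith [hy.1], hy.2.le⟩ h4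
  have hder : ∀ θ ∈ Set.Ioo 0 (Real.pi / 2), HasDerivWithinAt (fun θ => t - b₁ * Real.sin θ ^ 2)
      (-(b₁ * (2 * Real.sin θ * Real.cos θ))) (Set.Ioo 0 (Real.pi / 2)) θ := by
    intro θ _
    have := (((Real.hasDerivAt_sin θ).pow 2).const_mul b₁).const_sub t
    apply HasDerivAt.hasDerivWithinAt
    simpa using this
  have hsub := MeasureTheory.integral_image_eq_integral_abs_deriv_smul measurableSet_Ioo hder hinj
    (fun x => Real.sqrt ((x - b₁) * (x - b₂) / (t - x)))
  rw [himg] at hsub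
  rw [intervalIntegral.integral_of_le (by linarith), MeasureTheory.integral_Ioc_eq_integral_Ioo,
    hsub]
  have hI : (∫ θ in Set.Ioo 0 (Real.pi / 2), |-(b₁ * (2 * Real.sin θ * Real.cos θ))| •
      Real.sqrt ((t - b₁ * Real.sin θ ^ 2 - b₁) * (t - b₁ * Real.sin θ ^ 2 - b₂)
        / (t - (t - b₁ * Real.sin θ ^ 2))))
      = ∫ θ in Set.Ioo 0 (Real.pi / 2), 2 * b₁ * Real.sqrt b₂ *
        (Real.cos θ ^ 2 * Real.sqrt (1 - m * Real.sin θ ^ 2)) := by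
    apply MeasureTheory.setIntegral_congr_fun measurableSet_Ioo
    intro θ hθ
    have h1 := hsin θ hθ
    have h2 := hcos θ hθ
    have h3 := Real.cos_sq' θ
    have hp := aux_pos m θ hm0 hm1 hθ.1 hθ.2
    have e : (t - b₁ * Real.sin θ ^ 2 - b₁) * (t - b₁ * Real.sin θ ^ 2 - b₂)
        / (t - (t - b₁ * Real.sin θ ^ 2))
        = b₂ * (1 - m * Real.sin θ ^ 2) * (Real.cos θ / Real.sin θ) ^ 2 := by
      have e1 : t - b₁ * Real.sin θ ^ 2 - b₁ = b₂ * (1 - m * Real.sin θ ^ 2) := by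
        rw [ht, hmb]; ring
      have e2 : t - b₁ * Real.sin θ ^ 2 - b₂ = b₁ * Real.cos θ ^ 2 := by
        rw [ht, h3]; ring
      have e3 : t - (t - b₁ * Real.sin θ ^ 2) = b₁ * Real.sin θ ^ 2 := by ring
      rw [e1, e2, e3]
      field_simp
    simp only
    rw [e, Real.sqrt_mul (by positivity), Real.sqrt_mul hb₂.le, Real.sqrt_sq (by positivity),
      abs_neg, abs_of_pos (by positivity), smul_eq_mul]
    field_simp
  rw [hI, ← MeasureTheory.integral_Ioc_eq_integral_Ioo,
    ← intervalIntegral.integral_of_le (by positivity), intervalIntegral.integral_const_mul]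
  have hA := aux_int m hm0 hm1
  have e1 : t * ellipticE m - (b₂ - b₁) * ellipticK m
      = b₂ * ((1 + m) * ellipticE m - (1 - m) * ellipticK m) := by
    rw [ht, hmb]; ring
  rw [e1, ← hA, hmb]
  ring
end

section
/- Let 0 < b < t. Then ∫₀^{√b} √( (b−x²)/(t−x²) ) · log √( (b−x²)/(t−x²) ) dx + ∫_{√t}^{∞} √( (x²−b)/(x²−t) ) · log √( (x²−b)/(x²−t) ) dx = (π/2) ∫_{√b}^{√t} √( (x²−b)/(t−x²) ) dx. In particular the improper integral over (√t, ∞) converges. -/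
open MeasureTheory

namespace HardEdge

noncomputable def q (b t : ℝ) (z : ℂ) : ℂ := (z ^ 2 - b) / (z ^ 2 - t)

noncomputable def F (b t : ℝ) (z : ℂ) : ℂ :=
  Complex.exp (Complex.log (q b t z) / 2) * (Complex.log (q b t z) / 2)

lemma den_ne (t : ℝ) (ht : 0 < t) (z : ℂ) (hy : 0 < z.im) :
    z ^ 2 - (t : ℂ) ≠ 0 := by
  intro h
  have h1 := congrArg Complex.re h
  have h2 := congrArg Complex.im h
  simp [pow_two] at h1 h2
  have h3 : z.re = 0 := by
    have : z.re * z.im = 0 := by linarith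
    rcases mul_eq_zero.1 this with h | h
    · exact h
    · linarith
  rw [h3] at h1
  nlinarith

lemma q_eq (b t : ℝ) (ht : 0 < t) (z : ℂ) (hy : 0 < z.im) :
    q b t z = 1 + ((t - b : ℝ) : ℂ) / (z ^ 2 - t) := by
  have := den_ne t ht z hy
  unfold q
  field_simp
  push_cast
  ring

lemma q_im_neg (b t : ℝ) (ht : 0 < t) (hbt : b < t) (z : ℂ) (hx : 0 < z.re) (hy : 0 < z.im) :
    (q b t z).im < 0 := by
  rw [q_eq b t ht z hy, Complex.add_im, Complex.div_im]
  have hn : 0 < Complex.normSq (z ^ 2 - (t : ℂ)) := Complex.normSq_pos.2 (den_ne t ht z hy)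
  have him : (z ^ 2 - (t : ℂ)).im = 2 * z.re * z.im := by
    simp [pow_two]; ring
  rw [him]
  simp only [Complex.one_im, Complex.ofReal_im, Complex.ofReal_re, zero_mul, zero_div, zero_sub,
    zero_add]
  have h3 : 0 < t - b := by linarith
  have : 0 < (t - b) * (2 * z.re * z.im) / Complex.normSq (z ^ 2 - (t : ℂ)) := by positivity
  linarith

lemma q_imag (b t y : ℝ) :
    q b t ((0 : ℝ) + y * Complex.I) = (((y ^ 2 + b) / (y ^ 2 + t) : ℝ) : ℂ) := by
  unfold q
  have : (((0 : ℝ) : ℂ) + y * Complex.I) ^ 2 = -(y : ℂ) ^ 2 := by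
    rw [Complex.ofReal_zero, zero_add, mul_pow, Complex.I_sq]; ring
  rw [this]
  push_cast
  rw [← neg_div_neg_eq]
  congr 1 <;> ring

lemma q_slit (b t : ℝ) (hb : 0 < b) (hbt : b < t) (z : ℂ) (hx : 0 ≤ z.re) (hy : 0 < z.im) :
    q b t z ∈ Complex.slitPlane := by
  rcases hx.eq_or_lt with h | h
  · have hz : z = (0 : ℝ) + z.im * Complex.I := by
      conv_lhs => rw [← Complex.re_add_im z, ← h]
    rw [hz, q_imag]
    apply Complex.ofReal_mem_slitPlane.2
    have : 0 < t := hb.trans hbt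
    positivity
  · exact Or.inr (q_im_neg b t (hb.trans hbt) hbt z h hy).ne

lemma F_diff (b t : ℝ) (hb : 0 < b) (hbt : b < t) (z : ℂ) (hx : 0 ≤ z.re) (hy : 0 < z.im) :
    DifferentiableAt ℂ (F b t) z := by
  have hq : DifferentiableAt ℂ (q b t) z := by
    unfold q
    exact DifferentiableAt.div (by fun_prop) (by fun_prop) (den_ne t (hb.trans hbt) z hy)
  have hl := (hq.clog (q_slit b t hb hbt z hx hy)).div_const 2
  exact hl.cexp.mul hl

lemma F_of_pos (b t : ℝ) (z : ℂ) (r : ℝ) (hr : 0 < r) (h : q b t z = (r : ℂ)) :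
    F b t z = ((√r * Real.log √r : ℝ) : ℂ) := by
  unfold F
  rw [h, ← Complex.ofReal_log hr.le, Real.log_sqrt hr.le]
  have : √r = Real.exp (Real.log r / 2) := by rw [Real.exp_half, Real.exp_log hr]
  rw [this]
  push_cast
  rfl

lemma norm_F_le (b t : ℝ) (hb : 0 < b) (hbt : b < t) (z : ℂ) (hx : 0 ≤ z.re) (hy : 0 < z.im) :
    ‖F b t z‖ ≤ 6 * (1 + ‖q b t z‖ ^ (3 / 4 : ℝ)) := by
  have hq0 : q b t z ≠ 0 := Complex.slitPlane_ne_zero (q_slit b t hb hbt z hx hy)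
  have hn : 0 < ‖q b t z‖ := norm_pos_iff.2 hq0
  set l := Real.log ‖q b t z‖ with hl
  set p := Real.exp (l / 4) with hp
  have hp0 : 0 < p := Real.exp_pos _
  have h1 : ‖Complex.exp (Complex.log (q b t z) / 2)‖ = p ^ 2 := by
    rw [Complex.norm_exp, hp, ← Real.exp_nat_mul]
    congr 1
    rw [show (Complex.log (q b t z) / 2) = Complex.log (q b t z) / ((2 : ℝ) : ℂ) by simp,
      Complex.div_ofReal_re, Complex.log_re]
    push_cast; ring
  have h2 : ‖Complex.log (q b t z)‖ ≤ |l| + Real.pi := by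
    refine (Complex.norm_le_abs_re_add_abs_im _).trans ?_
    rw [Complex.log_re, Complex.log_im]
    gcongr
    exact Complex.abs_arg_le_pi _
  have h3 : ‖q b t z‖ ^ (3 / 4 : ℝ) = p ^ 3 := by
    rw [Real.rpow_def_of_pos hn, hp, ← Real.exp_nat_mul]
    congr 1
    push_cast; ring
  have h4 : p * |l| ≤ 4 * p ^ 2 + 4 := by
    have e1 : l / 4 + 1 ≤ p := Real.add_one_le_exp _
    have e2 : -(l / 4) + 1 ≤ p⁻¹ := by
      rw [hp, ← Real.exp_neg]; exact Real.add_one_le_exp _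
    have e3 : p * p⁻¹ = 1 := mul_inv_cancel₀ hp0.ne'
    rcases abs_cases l with ⟨h, _⟩ | ⟨h, _⟩ <;> rw [h] <;> nlinarith
  rw [h3]
  unfold F
  rw [norm_mul, h1, norm_div]
  have h5 : ‖(2 : ℂ)‖ = 2 := by simp
  rw [h5]
  have h6 := Real.pi_le_four
  calc p ^ 2 * (‖Complex.log (q b t z)‖ / 2) ≤ p ^ 2 * ((|l| + 4) / 2) := by gcongr; linarith
    _ = p * (p * |l|) / 2 + 2 * p ^ 2 := by ring
    _ ≤ p * (4 * p ^ 2 + 4) / 2 + 2 * p ^ 2 := by gcongr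
    _ ≤ _ := by nlinarith [sq_nonneg (p - 1), mul_nonneg hp0.le (sq_nonneg (p - 1)),
      mul_nonneg hp0.le (sq_nonneg p)]

lemma norm_F_far (b t : ℝ) (hb : 0 < b) (hbt : b < t) (z : ℂ) (hy : 0 < z.im)
    (R : ℝ) (hR : 0 < R) (hRt : 4 * t ≤ R ^ 2) (hz : R ≤ ‖z‖) :
    ‖F b t z‖ ≤ 4 * t / R ^ 2 := by
  have ht := hb.trans hbt
  set u : ℂ := ((t - b : ℝ) : ℂ) / (z ^ 2 - t) with hu
  have hd : 3 / 4 * R ^ 2 ≤ ‖z ^ 2 - (t : ℂ)‖ := by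
    have := norm_sub_norm_le (z ^ 2) (t : ℂ)
    rw [norm_pow, Complex.norm_real, Real.norm_eq_abs, abs_of_pos ht] at this
    have : R ^ 2 ≤ ‖z‖ ^ 2 := by gcongr
    linarith
  have hun : ‖u‖ ≤ 4 / 3 * t / R ^ 2 := by
    rw [hu, norm_div, Complex.norm_real, Real.norm_eq_abs, abs_of_pos (by linarith)]
    calc (t - b) / ‖z ^ 2 - (t : ℂ)‖ ≤ t / (3 / 4 * R ^ 2) := by gcongr; linarith
      _ = _ := by field_simp; 
  have hu2 : 4 / 3 * t / R ^ 2 ≤ 1 / 2 := by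
    rw [div_le_iff₀ (by positivity)]; linarith
  have hl := Complex.norm_log_one_add_half_le_self (hun.trans hu2)
  rw [hu, ← q_eq b t ht z hy, ← hu] at hl
  have hl2 : ‖Complex.log (q b t z)‖ ≤ 2 * (t / R ^ 2) := by
    refine hl.trans ?_
    have : 3 / 2 * ‖u‖ ≤ 3 / 2 * (4 / 3 * t / R ^ 2) := by gcongr
    refine this.trans (le_of_eq (by ring))
  have he : ‖Complex.exp (Complex.log (q b t z) / 2)‖ ≤ 4 := by
    rw [Complex.norm_exp]
    have h1 : (Complex.log (q b t z) / 2).re ≤ 1 := by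
      refine (Complex.re_le_norm _).trans ?_
      rw [norm_div]
      have h5 : ‖(2 : ℂ)‖ = 2 := by simp
      rw [h5]
      linarith [hun.trans hu2]
    calc Real.exp _ ≤ Real.exp 1 := Real.exp_le_exp.2 h1
      _ ≤ 4 := by linarith [Real.exp_one_lt_d9]
  unfold F
  rw [norm_mul, norm_div]
  have h5 : ‖(2 : ℂ)‖ = 2 := by simp
  rw [h5]
  calc _ ≤ 4 * (2 * (t / R ^ 2) / 2) := by gcongr
    _ = _ := by ring

lemma norm_q_le (b t a : ℝ) (hb : 0 < b) (hbt : b < t) (ha : 0 < a) (hat : a ^ 2 = t)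
    (z : ℂ) (hx : 0 ≤ z.re) (hx2 : z.re ≤ 2 * a) (hxa : z.re ≠ a) (hy : 0 < z.im)
    (hy1 : z.im ≤ 1) :
    ‖q b t z‖ ≤ (5 * t + 1) / a * |z.re - a|⁻¹ := by
  have hn : ‖z ^ 2 - (b : ℂ)‖ ≤ 5 * t + 1 := by
    refine (norm_sub_le _ _).trans ?_
    rw [norm_pow, Complex.norm_real, Real.norm_eq_abs, abs_of_pos hb, ← Complex.normSq_eq_norm_sq,
      Complex.normSq_apply]
    nlinarith
  have hd : a * |z.re - a| ≤ ‖z ^ 2 - (t : ℂ)‖ := by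
    have : z ^ 2 - (t : ℂ) = (z + a) * (z - a) := by rw [← hat]; push_cast; ring
    rw [this, norm_mul]
    gcongr
    · refine le_trans ?_ (Complex.re_le_norm _)
      simp; exact hx
    · refine le_trans (le_of_eq ?_) (Complex.abs_re_le_norm _)
      simp
  have h0 : 0 < |z.re - a| := abs_pos.2 (sub_ne_zero.2 hxa)
  unfold q
  rw [norm_div]
  calc _ ≤ (5 * t + 1) / (a * |z.re - a|) := by gcongr; linarith
    _ = _ := by field_simp

/-- Dominating function. -/
noncomputable def G (t a x : ℝ) : ℝ :=
  if x ≤ 2 * a then 6 * (1 + ((5 * t + 1) / a) ^ (3 / 4 : ℝ) * |x - a| ^ (-(3 / 4) : ℝ))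
  else 4 * t * x ^ (-2 : ℝ)

lemma F_le_G (b t a : ℝ) (hb : 0 < b) (hbt : b < t) (ha : 0 < a) (hat : a ^ 2 = t)
    (x y : ℝ) (hx : 0 < x) (hxa : x ≠ a) (hy : 0 < y) (hy1 : y ≤ 1) :
    ‖F b t (x + y * Complex.I)‖ ≤ G t a x := by
  have hre : ((x : ℂ) + y * Complex.I).re = x := by simp
  have him : ((x : ℂ) + y * Complex.I).im = y := by simp
  unfold G
  split_ifs with h
  · refine (norm_F_le b t hb hbt _ (by rw [hre]; exact hx.le) (by rw [him]; exact hy)).trans ?_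
    have hq := norm_q_le b t a hb hbt ha hat (x + y * Complex.I) (by rw [hre]; exact hx.le)
      (by rw [hre]; exact h) (by rw [hre]; exact hxa) (by rw [him]; exact hy)
      (by rw [him]; exact hy1)
    rw [hre] at hq
    have ht := hb.trans hbt
    have : ‖q b t (x + y * Complex.I)‖ ^ (3 / 4 : ℝ) ≤
        ((5 * t + 1) / a * |x - a|⁻¹) ^ (3 / 4 : ℝ) := by gcongr
    rw [Real.mul_rpow (by positivity) (by positivity), Real.inv_rpow (abs_nonneg _),
      ← Real.rpow_neg (abs_nonneg _)] at this
    linarith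
  · push Not at h
    have := norm_F_far b t hb hbt (x + y * Complex.I) (by rw [him]; exact hy) x hx
      (by rw [← hat]; nlinarith) (by
        refine le_trans (le_of_eq hre.symm) (Complex.re_le_norm _))
    refine this.trans (le_of_eq ?_)
    rw [Real.rpow_neg hx.le, div_eq_mul_inv]
    norm_num

lemma G_int (t a : ℝ) (ha : 0 < a) : IntegrableOn (G t a) (Set.Ioi 0) := by
  rw [← Set.Ioc_union_Ioi_eq_Ioi (by positivity : (0 : ℝ) ≤ 2 * a)]
  apply IntegrableOn.union
  · have h1 : IntervalIntegrable (fun x : ℝ => |x - a| ^ (-(3 / 4) : ℝ)) volume 0 (2 * a) := by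
      have := (intervalIntegral.intervalIntegrable_cpow' (a := -a) (b := a)
        (r := ((-(3 / 4) : ℝ) : ℂ)) (by rw [Complex.ofReal_re]; norm_num)).norm
      have h2 := this.comp_sub_right a
      rw [neg_add_cancel, ← two_mul] at h2
      simpa only [Complex.norm_cpow_real, Complex.norm_real, Real.norm_eq_abs] using h2
    have h3 : IntervalIntegrable (fun x : ℝ => 6 * (1 + ((5 * t + 1) / a) ^ (3 / 4 : ℝ) *
        |x - a| ^ (-(3 / 4) : ℝ))) volume 0 (2 * a) :=
      ((intervalIntegrable_const).add (h1.const_mul _)).const_mul _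
    rw [intervalIntegrable_iff_integrableOn_Ioc_of_le (by positivity)] at h3
    refine h3.congr_fun (fun x hx => ?_) measurableSet_Ioc
    simp only [G, if_pos hx.2]
  · have := (integrableOn_Ioi_rpow_of_lt (a := -2) (c := 2 * a) (by norm_num)
      (by positivity)).const_mul (4 * t)
    refine IntegrableOn.congr_fun this (fun x hx => ?_) measurableSet_Ioi
    simp only [G, if_neg (not_le.2 (Set.mem_Ioi.1 hx))]

/-- boundary value -/
noncomputable def f (b t x : ℝ) : ℝ :=
  if 0 < (x ^ 2 - b) / (x ^ 2 - t) then
    √((x ^ 2 - b) / (x ^ 2 - t)) * Real.log √((x ^ 2 - b) / (x ^ 2 - t))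
  else -(Real.pi / 2) * √(-((x ^ 2 - b) / (x ^ 2 - t)))

open Filter Topology

lemma F_lim (b t x : ℝ) (hb : 0 < b) (hbt : b < t) (hx : 0 < x) (h1 : x ^ 2 ≠ b)
    (h2 : x ^ 2 ≠ t) :
    Tendsto (fun n : ℕ => (F b t (x + ((1 / ((n : ℝ) + 1) : ℝ) : ℂ) * Complex.I)).re) atTop
      (𝓝 (f b t x)) := by
  set r := (x ^ 2 - b) / (x ^ 2 - t) with hr
  have hr0 : r ≠ 0 := div_ne_zero (sub_ne_zero.2 h1) (sub_ne_zero.2 h2)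
  have hqx : q b t x = (r : ℂ) := by simp [q, hr]
  have hz : Tendsto (fun n : ℕ => (x : ℂ) + ((1 / ((n : ℝ) + 1) : ℝ) : ℂ) * Complex.I) atTop
      (𝓝 (x : ℂ)) := by
    have := (Complex.continuous_ofReal.tendsto _).comp
      (tendsto_one_div_add_atTop_nhds_zero_nat (𝕜 := ℝ))
    simpa using (this.mul_const Complex.I).const_add (x : ℂ)
  have hq : Tendsto (fun n : ℕ => q b t (x + ((1 / ((n : ℝ) + 1) : ℝ) : ℂ) * Complex.I)) atTop
      (𝓝 (r : ℂ)) := by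
    rw [← hqx]
    have : ContinuousAt (q b t) (x : ℂ) := by
      unfold q
      refine ContinuousAt.div (by fun_prop) (by fun_prop) ?_
      have := sub_ne_zero.2 h2
      exact_mod_cast this
    exact this.tendsto.comp hz
  have key : ∀ L : ℂ, Tendsto (fun n : ℕ => Complex.log
      (q b t (x + ((1 / ((n : ℝ) + 1) : ℝ) : ℂ) * Complex.I))) atTop (𝓝 L) →
      Tendsto (fun n : ℕ => (F b t (x + ((1 / ((n : ℝ) + 1) : ℝ) : ℂ) * Complex.I)).re) atTop
      (𝓝 (Complex.exp (L / 2) * (L / 2)).re) := by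
    intro L hL
    have h := hL.div_const 2
    exact (Complex.continuous_re.tendsto _).comp
      (((Complex.continuous_exp.tendsto _).comp h).mul h)
  rcases lt_or_gt_of_ne hr0 with h | h
  · have hL : Tendsto (fun n : ℕ => Complex.log
      (q b t (x + ((1 / ((n : ℝ) + 1) : ℝ) : ℂ) * Complex.I))) atTop
        (𝓝 (Real.log ‖(r : ℂ)‖ - Real.pi * Complex.I)) := by
      refine (Complex.tendsto_log_nhdsWithin_im_neg_of_re_neg_of_im_zero
        (z := (r : ℂ)) (by simpa using h) (by simp)).comp ?_
      refine tendsto_nhdsWithin_iff.2 ⟨hq, Eventually.of_forall fun n => ?_⟩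
      refine q_im_neg b t (hb.trans hbt) hbt _ (by simpa using hx) ?_
      simp only [Complex.add_im, Complex.ofReal_im, Complex.mul_im, Complex.ofReal_re,
        Complex.I_im, Complex.I_re, mul_one, mul_zero, zero_add, add_zero]
      positivity
    convert key _ hL using 2
    rw [f, if_neg (not_lt.2 h.le), ← hr, Complex.norm_real, Real.norm_eq_abs, abs_of_neg h]
    have hs : √(-r) = Real.exp (Real.log (-r) / 2) := by
      rw [Real.exp_half, Real.exp_log (by linarith)]
    have he : Complex.exp ((Real.log (-r) - Real.pi * Complex.I) / 2) =
        (√(-r) : ℝ) * (-Complex.I) := by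
      rw [sub_div, Complex.exp_sub, hs, div_eq_mul_inv, ← Complex.exp_neg]
      have : -((Real.pi : ℂ) * Complex.I / 2) = -(Real.pi : ℂ) / 2 * Complex.I := by ring
      rw [this, Complex.exp_neg_pi_div_two_mul_I]
      push_cast
      rfl
    rw [he]
    have : (√(-r) : ℂ) * (-Complex.I) * ((Real.log (-r) - Real.pi * Complex.I) / 2) =
        ((-(Real.pi / 2) * √(-r) : ℝ) : ℂ) + ((-(√(-r) * Real.log (-r) / 2) : ℝ) : ℂ) * Complex.I := by
      push_cast
      linear_combination (√(-r) : ℂ) * Real.pi / 2 * Complex.I_sq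
    rw [this]
    simp
  · have hL := hq.clog (Complex.ofReal_mem_slitPlane.2 h)
    convert key _ hL using 2
    rw [f, if_pos h, ← hr]
    have := F_of_pos b t x r h hqx
    rw [F, hqx] at this
    rw [this, Complex.ofReal_re]

lemma F_cont (b t : ℝ) (hb : 0 < b) (hbt : b < t) (y : ℝ) (hy : 0 < y) :
    ContinuousOn (fun x : ℝ => F b t (x + y * Complex.I)) (Set.Ici 0) := by
  intro x hx
  refine ContinuousAt.continuousWithinAt ?_
  have h := (F_diff b t hb hbt (x + y * Complex.I) (by simpa using hx) (by simpa using hy)).continuousAt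
  exact ContinuousAt.comp (f := fun x : ℝ => (x : ℂ) + y * Complex.I) h (by fun_prop)

/-- bottom integrals are `O(1/N)` -/
lemma rect (b t : ℝ) (hb : 0 < b) (hbt : b < t) (N e : ℝ) (hN : 1 ≤ N) (hNt : 4 * t ≤ N ^ 2)
    (he : 0 < e) (he1 : e ≤ 1) :
    |∫ x in (0 : ℝ)..N, (F b t (x + e * Complex.I)).re| ≤ 8 * t / N := by
  have ht := hb.trans hbt
  have H := Complex.integral_boundary_rect_eq_zero_of_differentiableOn (F b t)
    (((0 : ℝ) : ℂ) + e * Complex.I) (N + N * Complex.I) (by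
      intro z hz
      rw [Complex.mem_reProdIm] at hz
      simp only [Complex.add_re, Complex.add_im, Complex.mul_re, Complex.mul_im, Complex.ofReal_re,
        Complex.ofReal_im, Complex.I_re, Complex.I_im, mul_one, mul_zero, zero_add, add_zero,
        sub_zero, zero_mul] at hz
      rw [Set.uIcc_of_le (by linarith), Set.uIcc_of_le (by linarith)] at hz
      exact (F_diff b t hb hbt z hz.1.1 (by linarith [hz.2.1])).differentiableWithinAt)
  simp only [Complex.add_re, Complex.add_im, Complex.mul_re, Complex.mul_im, Complex.ofReal_re,
        Complex.ofReal_im, Complex.I_re, Complex.I_im, mul_one, mul_zero, zero_add, add_zero,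
        sub_zero, zero_mul] at H
  have hleft : (∫ y in e..N, F b t (((0 : ℝ) : ℂ) + y * Complex.I)) =
      ((∫ y in e..N, √((y ^ 2 + b) / (y ^ 2 + t)) * Real.log √((y ^ 2 + b) / (y ^ 2 + t)) : ℝ) : ℂ) := by
    rw [← intervalIntegral.integral_ofReal]
    refine intervalIntegral.integral_congr fun y _ => ?_
    exact F_of_pos b t _ _ (by positivity) (q_imag b t y)
  have htop : ‖∫ x in (0 : ℝ)..N, F b t (x + N * Complex.I)‖ ≤ 4 * t / N ^ 2 * |N - 0| := by
    refine intervalIntegral.norm_integral_le_of_norm_le_const fun x hx => ?_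
    refine norm_F_far b t hb hbt _ (by simp; linarith) N (by linarith) hNt ?_
    refine le_trans (le_of_eq ?_) (Complex.im_le_norm _)
    simp
  have hright : ‖∫ y in e..N, F b t (N + y * Complex.I)‖ ≤ 4 * t / N ^ 2 * |N - e| := by
    refine intervalIntegral.norm_integral_le_of_norm_le_const fun y hy => ?_
    rw [Set.uIoc_of_le (by linarith)] at hy
    refine norm_F_far b t hb hbt _ (by simp; linarith [hy.1]) N (by linarith) hNt ?_
    refine le_trans (le_of_eq ?_) (Complex.re_le_norm _)
    simp
  have hbot : (∫ x in (0 : ℝ)..N, (F b t (x + e * Complex.I)).re) =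
      (∫ x in (0 : ℝ)..N, F b t (x + e * Complex.I)).re := by
    have hi : IntervalIntegrable (fun x : ℝ => F b t (x + e * Complex.I)) volume 0 N :=
      ((F_cont b t hb hbt e he).mono (by
        rw [Set.uIcc_of_le (by linarith)]; exact Set.Icc_subset_Ici_self)).intervalIntegrable
    exact Complex.reCLM.intervalIntegral_comp_comm hi
  rw [hbot]
  rw [hleft] at H
  set B := ∫ x in (0 : ℝ)..N, F b t (x + e * Complex.I)
  set T := ∫ x in (0 : ℝ)..N, F b t (x + N * Complex.I)
  set R := ∫ y in e..N, F b t (N + y * Complex.I)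
  have H2 := congrArg Complex.re H
  simp only [smul_eq_mul, Complex.add_re, Complex.sub_re, Complex.mul_re, Complex.I_re,
    Complex.I_im, Complex.ofReal_re, Complex.ofReal_im, Complex.zero_re] at H2
  have hB : B.re = T.re + R.im := by linarith
  rw [hB]
  have e1 : 4 * t / N ^ 2 * |N - 0| = 4 * t / N := by
    rw [sub_zero, abs_of_pos (by linarith)]; field_simp
  have e2 : 4 * t / N ^ 2 * |N - e| ≤ 4 * t / N := by
    rw [← e1]
    refine mul_le_mul_of_nonneg_left ?_ (by positivity)
    rw [abs_of_nonneg (by linarith), abs_of_nonneg (by linarith)]; linarith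
  calc |T.re + R.im| ≤ |T.re| + |R.im| := abs_add_le _ _
    _ ≤ ‖T‖ + ‖R‖ := add_le_add (Complex.abs_re_le_norm _) (Complex.abs_im_le_norm _)
    _ ≤ 4 * t / N + 4 * t / N := by linarith
    _ = _ := by ring

lemma main (b t : ℝ) (hb : 0 < b) (hbt : b < t) :
    IntegrableOn (f b t) (Set.Ioi 0) ∧ ∫ x in Set.Ioi 0, f b t x = 0 := by
  have ht := hb.trans hbt
  set a := √t with ha'
  have ha : 0 < a := Real.sqrt_pos.2 ht
  have hat : a ^ 2 = t := Real.sq_sqrt ht.le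
  let u : ℕ → ℝ → ℝ := fun n => (Set.Iic ((n : ℝ) + 1)).indicator
    (fun x => (F b t (x + ((1 / ((n : ℝ) + 1) : ℝ) : ℂ) * Complex.I)).re)
  have he0 : ∀ n : ℕ, 0 < 1 / ((n : ℝ) + 1) := fun n => by positivity
  have he1 : ∀ n : ℕ, 1 / ((n : ℝ) + 1) ≤ 1 := fun n => by
    rw [div_le_one (by positivity)]; have : (0 : ℝ) ≤ n := by positivity
    linarith
  have hmeas : ∀ n, AEStronglyMeasurable (u n) (volume.restrict (Set.Ioi 0)) := fun n => by
    refine AEStronglyMeasurable.indicator ?_ measurableSet_Iic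
    refine ContinuousOn.aestronglyMeasurable ?_ measurableSet_Ioi
    exact Complex.continuous_re.comp_continuousOn
      ((F_cont b t hb hbt _ (he0 n)).mono Set.Ioi_subset_Ici_self)
  have hae : ∀ᵐ x ∂(volume.restrict (Set.Ioi (0 : ℝ))), 0 < x ∧ x ≠ √b ∧ x ≠ a := by
    filter_upwards [ae_restrict_mem measurableSet_Ioi,
      ae_restrict_of_ae (Measure.ae_ne volume (√b)),
      ae_restrict_of_ae (Measure.ae_ne volume a)] with x h1 h2 h3
    exact ⟨h1, h2, h3⟩
  have hbound : ∀ n, ∀ᵐ x ∂(volume.restrict (Set.Ioi (0 : ℝ))), ‖u n x‖ ≤ G t a x := fun n => by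
    filter_upwards [hae] with x hx
    have h := F_le_G b t a hb hbt ha hat x _ hx.1 hx.2.2 (he0 n) (he1 n)
    refine (norm_indicator_le_norm_self _ _).trans ?_
    exact (Complex.abs_re_le_norm _).trans h
  have hlim : ∀ᵐ x ∂(volume.restrict (Set.Ioi (0 : ℝ))),
      Tendsto (fun n => u n x) atTop (𝓝 (f b t x)) := by
    filter_upwards [hae] with x hx
    have h := F_lim b t x hb hbt hx.1
      (fun h => hx.2.1 (by rw [← h, Real.sqrt_sq hx.1.le]))
      (fun h => hx.2.2 (by rw [ha', ← h, Real.sqrt_sq hx.1.le]))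
    refine h.congr' ?_
    filter_upwards [tendsto_natCast_atTop_atTop.eventually_ge_atTop x] with n hn
    have hm : x ∈ Set.Iic ((n : ℝ) + 1) := Set.mem_Iic.2 (by linarith)
    simp only [u, Set.indicator_of_mem hm]
  have hG := G_int t a ha
  refine ⟨?_, ?_⟩
  · refine Integrable.mono' hG (aestronglyMeasurable_of_tendsto_ae atTop hmeas hlim) ?_
    filter_upwards [hlim, ae_all_iff.2 hbound] with x h1 h2
    exact le_of_tendsto h1.norm (Eventually.of_forall h2)
  · have h := tendsto_integral_of_dominated_convergence _ hmeas hG hbound hlim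
    refine tendsto_nhds_unique h ?_
    have hN : Tendsto (fun n : ℕ => (n : ℝ) + 1) atTop atTop :=
      tendsto_atTop_add_const_right _ _ tendsto_natCast_atTop_atTop
    refine squeeze_zero_norm' ?_ (hN.const_div_atTop (8 * t))
    filter_upwards [hN.eventually_ge_atTop (2 * a)] with n hn
    have hn0 : (0 : ℝ) ≤ n := by positivity
    rw [setIntegral_indicator measurableSet_Iic, Set.Ioi_inter_Iic,
      ← intervalIntegral.integral_of_le (by linarith), Real.norm_eq_abs]
    exact rect b t hb hbt _ _ (by linarith) (by rw [← hat]; nlinarith) (he0 n) (he1 n)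

end HardEdge


/-- Hard-edge entropy computation (eq. (21.3) and (V2v)): for `0 < b < t`,
`∫₀^{√b} √((b-x²)/(t-x²)) log √((b-x²)/(t-x²)) dx
  + ∫_{√t}^∞ √((x²-b)/(x²-t)) log √((x²-b)/(x²-t)) dx
  = (π/2) ∫_{√b}^{√t} √((x²-b)/(t-x²)) dx`,
the improper integral over `(√t, ∞)` being convergent. -/
theorem stmt10 (b t : ℝ) (hb : 0 < b) (hbt : b < t) :
    IntegrableOn
        (fun x : ℝ => Real.sqrt ((x ^ 2 - b) / (x ^ 2 - t)) *
          Real.log (Real.sqrt ((x ^ 2 - b) / (x ^ 2 - t))))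
        (Set.Ioi (Real.sqrt t)) ∧
    (∫ x in (0:ℝ)..Real.sqrt b,
        Real.sqrt ((b - x ^ 2) / (t - x ^ 2)) *
          Real.log (Real.sqrt ((b - x ^ 2) / (t - x ^ 2))))
      + (∫ x in Set.Ioi (Real.sqrt t),
          Real.sqrt ((x ^ 2 - b) / (x ^ 2 - t)) *
            Real.log (Real.sqrt ((x ^ 2 - b) / (x ^ 2 - t))))
      = Real.pi / 2 *
          ∫ x in Real.sqrt b..Real.sqrt t, Real.sqrt ((x ^ 2 - b) / (t - x ^ 2)) := by
  obtain ⟨hi, h0⟩ := HardEdge.main b t hb hbt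
  have ht := hb.trans hbt
  have hsb : 0 < √b := Real.sqrt_pos.2 hb
  have hst : √b < √t := Real.sqrt_lt_sqrt hb.le hbt
  have b2 : √b ^ 2 = b := Real.sq_sqrt hb.le
  have t2 : √t ^ 2 = t := Real.sq_sqrt ht.le
  have c1 : ∀ x ∈ Set.Ioo 0 √b, HardEdge.f b t x = Real.sqrt ((b - x ^ 2) / (t - x ^ 2)) *
          Real.log (Real.sqrt ((b - x ^ 2) / (t - x ^ 2))) := fun x hx => by
    have h1 : x ^ 2 < b := by rw [← b2]; have := hx.1; have := hx.2; gcongr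
    have h2 : (x ^ 2 - b) / (x ^ 2 - t) = (b - x ^ 2) / (t - x ^ 2) := by
      rw [← neg_div_neg_eq]; congr 1 <;> ring
    rw [HardEdge.f, h2, if_pos (div_pos (by linarith) (by linarith))]
  have c2 : ∀ x ∈ Set.Ioo √b √t, HardEdge.f b t x =
      -(Real.pi / 2) * Real.sqrt ((x ^ 2 - b) / (t - x ^ 2)) := fun x hx => by
    have h0 : 0 < x := hsb.trans hx.1
    have h1 : b < x ^ 2 := by rw [← b2]; have := hx.1; gcongr
    have h3 : x ^ 2 < t := by rw [← t2]; have := hx.2; gcongr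
    have h2 : -((x ^ 2 - b) / (x ^ 2 - t)) = (x ^ 2 - b) / (t - x ^ 2) := by
      rw [← div_neg]; congr 1; ring
    rw [HardEdge.f, if_neg, h2]
    have : 0 < (x ^ 2 - b) / (t - x ^ 2) := div_pos (by linarith) (by linarith)
    linarith
  have c3 : ∀ x ∈ Set.Ioi √t, HardEdge.f b t x = Real.sqrt ((x ^ 2 - b) / (x ^ 2 - t)) *
          Real.log (Real.sqrt ((x ^ 2 - b) / (x ^ 2 - t))) := fun x hx => by
    have h1 : t < x ^ 2 := by rw [← t2]; have := Set.mem_Ioi.1 hx; gcongr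
    rw [HardEdge.f, if_pos (div_pos (by linarith) (by linarith))]
  have i3 : IntegrableOn (HardEdge.f b t) (Set.Ioi √t) := hi.mono_set (Set.Ioi_subset_Ioi (by linarith))
  have i2 : IntegrableOn (HardEdge.f b t) (Set.Ioc √b √t) :=
    hi.mono_set (fun x hx => hsb.trans hx.1)
  have i1 : IntegrableOn (HardEdge.f b t) (Set.Ioc 0 √b) := hi.mono_set (fun x hx => hx.1)
  have i23 : IntegrableOn (HardEdge.f b t) (Set.Ioi √b) := hi.mono_set (Set.Ioi_subset_Ioi hsb.le)
  refine ⟨i3.congr_fun c3 measurableSet_Ioi, ?_⟩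
  rw [← Set.Ioc_union_Ioi_eq_Ioi hsb.le,
    setIntegral_union (Set.Ioc_disjoint_Ioi le_rfl) measurableSet_Ioi i1 i23,
    ← Set.Ioc_union_Ioi_eq_Ioi hst.le,
    setIntegral_union (Set.Ioc_disjoint_Ioi le_rfl) measurableSet_Ioi i2 i3,
    integral_Ioc_eq_integral_Ioo, integral_Ioc_eq_integral_Ioo,
    setIntegral_congr_fun measurableSet_Ioo c1, setIntegral_congr_fun measurableSet_Ioo c2,
    setIntegral_congr_fun measurableSet_Ioi c3, integral_const_mul] at h0
  rw [intervalIntegral.integral_of_le hsb.le, intervalIntegral.integral_of_le hst.le,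
    integral_Ioc_eq_integral_Ioo, integral_Ioc_eq_integral_Ioo]
  linarith
end

section
/- The improper integral ∫₁^∞ ( (x − 1/2)/√(x−1) ) · log( (x − 1/2)/(√x · √(x−1)) ) dx converges and equals (π/3)(√2 − 1/2). -/
open MeasureTheory

noncomputable def auxL (u : ℝ) : ℝ :=
  Real.log (u^2 + 1/2) - 1/2 * Real.log (1 + u^2) - Real.log u

noncomputable def auxF (u : ℝ) : ℝ :=
  (2*u^2/3 + 1) * (u * (Real.log (u^2 + 1/2) - 1/2 * Real.log (1 + u^2)) - u * Real.log u)
    - 1/3 * Real.arctan u + 2 * Real.sqrt 2 / 3 * Real.arctan (Real.sqrt 2 * u)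

lemma auxF_cont : Continuous auxF := by
  unfold auxF
  have h1 : Continuous fun u : ℝ => Real.log (u^2 + 1/2) :=
    Continuous.log (by fun_prop) (fun u => by positivity)
  have h2 : Continuous fun u : ℝ => Real.log (1 + u^2) :=
    Continuous.log (by fun_prop) (fun u => by positivity)
  have h3 := Real.continuous_mul_log
  have h4 := Real.continuous_arctan
  fun_prop

lemma auxF_deriv (u : ℝ) (hu : 0 < u) : HasDerivAt auxF (2 * (u^2 + 1/2) * auxL u) u := by
  have hs : Real.sqrt 2 ^ 2 = 2 := Real.sq_sqrt (by norm_num)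
  have e1 : HasDerivAt (fun u : ℝ => Real.log (u^2 + 1/2)) (2*u / (u^2+1/2)) u := by
    have := ((hasDerivAt_pow 2 u).add_const (1/2)).log (by positivity)
    simpa using this
  have e2 : HasDerivAt (fun u : ℝ => Real.log (1 + u^2)) (2*u / (1 + u^2)) u := by
    have := ((hasDerivAt_pow 2 u).const_add 1).log (by positivity)
    simpa using this
  have e3 := Real.hasDerivAt_log hu.ne'
  have e4 := Real.hasDerivAt_arctan u
  have e5 : HasDerivAt (fun u : ℝ => Real.arctan (Real.sqrt 2 * u))
      (1 / (1 + 2 * u^2) * Real.sqrt 2) u := by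
    have := ((hasDerivAt_id u).const_mul (Real.sqrt 2)).arctan
    simpa [mul_pow, hs] using this
  have e6 : HasDerivAt (fun u : ℝ => 2*u^2/3 + 1) (4*u/3) u := by
    have := (((hasDerivAt_pow 2 u).const_mul 2).div_const 3).add_const 1
    refine HasDerivAt.congr_deriv this ?_
    norm_num; ring
  have e7 := hasDerivAt_id' u
  have := ((e6.mul ((e7.mul (e1.sub (e2.const_mul (1/2)))).sub (e7.mul e3))).sub
    (e4.const_mul (1/3))).add (e5.const_mul (2 * Real.sqrt 2 / 3))
  refine HasDerivAt.congr_deriv this ?_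
  have h5 : 2 * Real.sqrt 2 / 3 * (1 / (1 + 2 * u^2) * Real.sqrt 2) = 4 / 3 / (1 + 2*u^2) := by
    rw [show 2 * Real.sqrt 2 / 3 * (1 / (1 + 2 * u^2) * Real.sqrt 2)
      = 2 / 3 * (1 / (1 + 2 * u^2)) * Real.sqrt 2 ^ 2 by ring, hs]; ring
  simp only [Pi.sub_apply, Pi.mul_apply]
  rw [h5]
  unfold auxL
  have a1 : u^2 + 1/2 ≠ 0 := by positivity
  have a2 : 1 + u^2 ≠ 0 := by positivity
  have a3 : 1 + 2*u^2 ≠ 0 := by positivity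
  have k1 : 2*u/(u^2+1/2) = 4*u/(1+2*u^2) := by field_simp; ring
  rw [k1]
  generalize Real.log (u^2 + 1/2) = A
  generalize Real.log (1 + u^2) = B
  generalize Real.log u = C
  field_simp
  ring

lemma auxL_eq (u : ℝ) (hu : 0 < u) :
    auxL u = 1/2 * Real.log (1 + 1 / (4*u^2*(1+u^2))) := by
  have : 1 + 1 / (4*u^2*(1+u^2)) = (u^2+1/2)^2 / ((1+u^2) * u^2) := by
    field_simp; ring
  rw [this, Real.log_div (by positivity) (by positivity), Real.log_mul (by positivity)
    (by positivity), Real.log_pow, Real.log_pow]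
  unfold auxL
  push_cast; ring

lemma auxL_nonneg (u : ℝ) (hu : 0 < u) : 0 ≤ auxL u := by
  rw [auxL_eq u hu]
  have : 0 ≤ Real.log (1 + 1 / (4*u^2*(1+u^2))) :=
    Real.log_nonneg (by have : 0 ≤ 1 / (4*u^2*(1+u^2)) := by positivity
                        linarith)
  linarith

lemma auxL_le (u : ℝ) (hu : 0 < u) : auxL u ≤ 1 / (8*u^2*(1+u^2)) := by
  rw [auxL_eq u hu]
  have := Real.log_le_sub_one_of_pos (x := 1 + 1 / (4*u^2*(1+u^2))) (by positivity)
  have h : 1 / (8*u^2*(1+u^2)) = 1/2 * (1 / (4*u^2*(1+u^2))) := by field_simp; norm_num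
  rw [h]; linarith

open Filter Topology in
lemma auxF_lim : Tendsto auxF atTop (𝓝 (Real.pi / 3 * (Real.sqrt 2 - 1/2))) := by
  have t1 : Tendsto (fun u : ℝ => (2*u^2/3+1) * u * auxL u) atTop (𝓝 0) := by
    refine squeeze_zero' (g := fun u : ℝ => u⁻¹) ?_ ?_ tendsto_inv_atTop_zero
    · filter_upwards [eventually_gt_atTop 0] with u hu
      have := auxL_nonneg u hu
      positivity
    · filter_upwards [eventually_gt_atTop 0] with u hu
      calc (2*u^2/3+1) * u * auxL u ≤ (2*u^2/3+1) * u * (1 / (8*u^2*(1+u^2))) := by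
            gcongr; exact auxL_le u hu
        _ ≤ (8*(1+u^2)) * u * (1 / (8*u^2*(1+u^2))) := by
            gcongr; nlinarith [sq_nonneg u]
        _ = u⁻¹ := by field_simp
  have a1 : Tendsto Real.arctan atTop (𝓝 (Real.pi/2)) :=
    Real.tendsto_arctan_atTop.mono_right nhdsWithin_le_nhds
  have a2 : Tendsto (fun u : ℝ => Real.arctan (Real.sqrt 2 * u)) atTop (𝓝 (Real.pi/2)) :=
    a1.comp (tendsto_id.const_mul_atTop (by positivity))
  have := (t1.sub (a1.const_mul (1/3))).add (a2.const_mul (2 * Real.sqrt 2 / 3))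
  refine (this.congr ?_).trans (le_of_eq ?_)
  · intro u; unfold auxF auxL; ring
  · congr 1; ring

/-- Soft-edge entropy integral (eq. (30t)):
`∫₁^∞ ((x - 1/2)/√(x-1)) log((x - 1/2)/(√x √(x-1))) dx` converges and equals
`(π/3)(√2 - 1/2)`. -/
theorem stmt11 :
    IntegrableOn
        (fun x : ℝ => (x - 1/2) / Real.sqrt (x - 1) *
          Real.log ((x - 1/2) / (Real.sqrt x * Real.sqrt (x - 1))))
        (Set.Ioi 1) ∧
    (∫ x in Set.Ioi (1:ℝ), (x - 1/2) / Real.sqrt (x - 1) *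
        Real.log ((x - 1/2) / (Real.sqrt x * Real.sqrt (x - 1))))
      = Real.pi / 3 * (Real.sqrt 2 - 1/2) := by
  have key : ∀ x ∈ Set.Ioi (1:ℝ),
      Real.log ((x - 1/2) / (Real.sqrt x * Real.sqrt (x - 1))) = auxL (Real.sqrt (x-1)) := by
    intro x hx
    have hx : 1 < x := hx
    have h1 : 0 < Real.sqrt (x-1) := Real.sqrt_pos.mpr (by linarith)
    have h2 : 0 < Real.sqrt x := Real.sqrt_pos.mpr (by linarith)
    have hq : x - 1/2 ≠ 0 := by linarith
    rw [Real.log_div hq (by positivity), Real.log_mul h2.ne' h1.ne']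
    unfold auxL
    rw [Real.sq_sqrt (by linarith), Real.log_sqrt (x := x) (by linarith),
      show x - 1 + 1/2 = x - 1/2 by ring, show 1 + (x-1) = x by ring]
    ring
  have hc : ContinuousWithinAt (fun x : ℝ => auxF (Real.sqrt (x-1))) (Set.Ici 1) 1 :=
    (auxF_cont.comp (Real.continuous_sqrt.comp (continuous_id.sub continuous_const))).continuousWithinAt
  have hd : ∀ x ∈ Set.Ioi (1:ℝ), HasDerivAt (fun x : ℝ => auxF (Real.sqrt (x-1)))
      ((x - 1/2) / Real.sqrt (x - 1) *
          Real.log ((x - 1/2) / (Real.sqrt x * Real.sqrt (x - 1)))) x := by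
    intro x hx
    rw [key x hx]
    have hx : 1 < x := hx
    have h1 : 0 < Real.sqrt (x-1) := Real.sqrt_pos.mpr (by linarith)
    have := ((hasDerivAt_id' x).sub_const 1).sqrt (by linarith : x - 1 ≠ 0)
    have h := (auxF_deriv _ h1).comp x this
    refine HasDerivAt.congr_deriv h ?_
    rw [Real.sq_sqrt (by linarith)]
    field_simp
    ring
  have hn : ∀ x ∈ Set.Ioi (1:ℝ), 0 ≤ (x - 1/2) / Real.sqrt (x - 1) *
          Real.log ((x - 1/2) / (Real.sqrt x * Real.sqrt (x - 1))) := by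
    intro x hx
    rw [key x hx]
    have hx : 1 < x := hx
    have h1 : 0 < Real.sqrt (x-1) := Real.sqrt_pos.mpr (by linarith)
    have := auxL_nonneg _ h1
    have : 0 ≤ x - 1/2 := by linarith
    positivity
  have hl : Filter.Tendsto (fun x : ℝ => auxF (Real.sqrt (x-1))) Filter.atTop
      (nhds (Real.pi / 3 * (Real.sqrt 2 - 1/2))) :=
    auxF_lim.comp (Real.tendsto_sqrt_atTop.comp (Filter.tendsto_atTop_add_const_right _ (-1) Filter.tendsto_id))
  refine ⟨integrableOn_Ioi_deriv_of_nonneg hc hd hn hl, ?_⟩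
  rw [integral_Ioi_of_hasDerivAt_of_nonneg hc hd hn hl]
  simp [auxF]
end
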